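/- arXiv:2301.13147 — 2 statements merged into one kernel-verified Lean document; each statement's English description precedes it below -/
import Mathlib

section
/- Let E be a real Banach space and D ⊊ E a c-John domain (c ≥ 1). If D is Gromov hyperbolic, i.e. (D, k_D) is δ-hyperbolic for some δ ≥ 0, then every c₀-neargeodesic in D (c₀ ≥ 1) is a b-cone arc, where the constant b depends only on c, c₀ and δ. -/
open Set Metric

noncomputable section

variable {E : Type*} [NormedAddCommGroup E] [NormedSpace ℝ E]

/-- `deltaBd D z` is the distance `Δ(z)` from `z` to the boundary `∂D`. -/
def deltaBd (D : Set E) (z : E) : ℝ := Metric.infDist z (frontier D)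

/-- `γ` is a rectifiable curve in `D`, parametrized by (norm) arclength on `[0, L]`:
it maps `[0, L]` into `D` and the length of the subarc `γ[γ s, γ t]` equals `t - s`. -/
def IsArcLengthParam (D : Set E) (γ : ℝ → E) (L : ℝ) : Prop :=
  0 ≤ L ∧ (∀ t ∈ Icc (0 : ℝ) L, γ t ∈ D) ∧
    ∀ s t : ℝ, 0 ≤ s → s ≤ t → t ≤ L →
      eVariationOn γ (Icc s t) = ENNReal.ofReal (t - s)

/-- The quasihyperbolic length `l_k(γ[γ a, γ b]) = ∫ ds / Δ` of the subarc between
parameters `a` and `b` of an arclength-parametrized curve `γ` in `D`. -/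
def qhLength (D : Set E) (γ : ℝ → E) (a b : ℝ) : ℝ :=
  ∫ t in a..b, 1 / deltaBd D (γ t)

/-- The quasihyperbolic metric `k_D(x,y)`: the infimum of quasihyperbolic lengths of
rectifiable curves in `D` joining `x` and `y`. -/
def qhDist (D : Set E) (x y : E) : ℝ :=
  sInf { l : ℝ | ∃ γ : ℝ → E, ∃ L : ℝ, IsArcLengthParam D γ L ∧
    γ 0 = x ∧ γ L = y ∧ l = qhLength D γ 0 L }

/-- An arclength-parametrized curve `γ : [0,L] → D` joining `x = γ 0` and `y = γ L` is a
`b`-cone arc if `min (l (γ[x,z])) (l (γ[z,y])) ≤ b * Δ z` for every point `z = γ t` on `γ`. -/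
def IsConeArc (D : Set E) (γ : ℝ → E) (L b : ℝ) : Prop :=
  ∀ t ∈ Icc (0 : ℝ) L, min t (L - t) ≤ b * deltaBd D (γ t)

/-- `D` is a `c`-John domain: every pair of points of `D` can be joined by a `c`-cone arc. -/
def IsJohnDomain (D : Set E) (c : ℝ) : Prop :=
  ∀ x ∈ D, ∀ y ∈ D, ∃ γ : ℝ → E, ∃ L : ℝ,
    IsArcLengthParam D γ L ∧ γ 0 = x ∧ γ L = y ∧ IsConeArc D γ L c

/-- A curve `γ` in `D` is a `c₀`-neargeodesic if `l_k(γ[x,y]) ≤ c₀ * k_D(x,y)` for all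
points `x, y` on `γ`. -/
def IsNeargeodesic (D : Set E) (γ : ℝ → E) (L c₀ : ℝ) : Prop :=
  IsArcLengthParam D γ L ∧
    ∀ s t : ℝ, 0 ≤ s → s ≤ t → t ≤ L →
      qhLength D γ s t ≤ c₀ * qhDist D (γ s) (γ t)

/-- The Gromov product `(x|y)_p` with respect to the quasihyperbolic metric on `D`. -/
def gromovProd (D : Set E) (p x y : E) : ℝ :=
  (qhDist D x p + qhDist D y p - qhDist D x y) / 2

/-- `(D, k_D)` is Gromov `δ`-hyperbolic. -/
def IsGromovHyperbolic (D : Set E) (δ : ℝ) : Prop :=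
  ∀ x ∈ D, ∀ y ∈ D, ∀ z ∈ D, ∀ p ∈ D,
    min (gromovProd D p x y) (gromovProd D p y z) - δ ≤ gromovProd D p x z

end


/-- A (pseudo)metric `d` satisfying the four-point form of Gromov `δ`-hyperbolicity. -/
structure IsHyperbolicDist {X : Type*} (d : X → X → ℝ) (δ : ℝ) : Prop where
  self : ∀ x, d x x = 0
  symm : ∀ x y, d x y = d y x
  nonneg : ∀ x y, 0 ≤ d x y
  tri : ∀ x y z, d x z ≤ d x y + d y z
  four : ∀ x y z p, min (d x p + d y p - d x y) (d y p + d z p - d y z) - 2 * δ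
    ≤ d x p + d z p - d x z

/-- A path `α` on `[s, t]`, with a continuous length function `ℓ`, whose subarcs have length at
most `lam` times the distance of their endpoints plus `h`. -/
structure IsQuasiPath {X : Type*} (d : X → X → ℝ) (α : ℝ → X) (ℓ : ℝ → ℝ) (s t lam h : ℝ) :
    Prop where
  le : s ≤ t
  cont : ContinuousOn ℓ (Icc s t)
  dist_le : ∀ u v, s ≤ u → u ≤ v → v ≤ t → d (α u) (α v) ≤ ℓ v - ℓ u
  len_le : ∀ u v, s ≤ u → u ≤ v → v ≤ t → ℓ v - ℓ u ≤ lam * d (α u) (α v) + h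

namespace IsQuasiPath

variable {X : Type*} {d : X → X → ℝ} {α β : ℝ → X} {ℓ m : ℝ → ℝ} {s t s' t' lam h δ : ℝ}

theorem mono (hα : IsQuasiPath d α ℓ s t lam h) {u v : ℝ} (hu : s ≤ u) (huv : u ≤ v)
    (hv : v ≤ t) : IsQuasiPath d α ℓ u v lam h where
  le := huv
  cont := hα.cont.mono (Icc_subset_Icc hu hv)
  dist_le a b ha hab hb := hα.dist_le a b (hu.trans ha) hab (hb.trans hv)
  len_le a b ha hab hb := hα.len_le a b (hu.trans ha) hab (hb.trans hv)

theorem exists_length_eq (hα : IsQuasiPath d α ℓ s t lam h) {r : ℝ} (h₁ : ℓ s ≤ r)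
    (h₂ : r ≤ ℓ t) : ∃ u, s ≤ u ∧ u ≤ t ∧ ℓ u = r := by
  obtain ⟨u, hu, rfl⟩ := intermediate_value_Icc hα.le hα.cont ⟨h₁, h₂⟩
  exact ⟨u, hu.1, hu.2, rfl⟩

theorem length_mono (hα : IsQuasiPath d α ℓ s t lam h) (H : IsHyperbolicDist d δ) {u v : ℝ}
    (hu : s ≤ u) (huv : u ≤ v) (hv : v ≤ t) : ℓ u ≤ ℓ v := by
  linarith [hα.dist_le u v hu huv hv, H.nonneg (α u) (α v)]

/-- If one of two properties holds at every point of a path, the first at its start and the second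
at its end, then they hold at two points that are close to each other. -/
theorem exists_close_pair (hα : IsQuasiPath d α ℓ s t lam h) (H : IsHyperbolicDist d δ)
    {P Q : ℝ → Prop} (hs : P s) (ht : Q t) (hPQ : ∀ u, s ≤ u → u ≤ t → P u ∨ Q u) :
    ∃ u v, u ∈ Icc s t ∧ v ∈ Icc s t ∧ P u ∧ Q v ∧ d (α u) (α v) ≤ 1 := by
  obtain ⟨n, hn⟩ := pow_unbounded_of_one_lt (ℓ t - ℓ s) (one_lt_two (α := ℝ))
  replace hn := hn.le
  induction n generalizing s t with
  | zero =>
    exact ⟨s, t, ⟨le_rfl, hα.le⟩, ⟨hα.le, le_rfl⟩, hs, ht,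
      (hα.dist_le s t le_rfl hα.le le_rfl).trans (by simpa using hn)⟩
  | succ n ih =>
    have hst := hα.length_mono H le_rfl hα.le le_rfl
    obtain ⟨w, hw₁, hw₂, hw⟩ := hα.exists_length_eq (r := (ℓ s + ℓ t) / 2)
      (by linarith) (by linarith)
    rw [pow_succ] at hn
    rcases hPQ w hw₁ hw₂ with hP | hQ
    · obtain ⟨u, v, hu, hv, h'⟩ := ih (hα.mono hw₁ hw₂ le_rfl) hP ht
        (fun u h₁ h₂ => hPQ u (hw₁.trans h₁) h₂) (by linarith)
      exact ⟨u, v, ⟨hw₁.trans hu.1, hu.2⟩, ⟨hw₁.trans hv.1, hv.2⟩, h'⟩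
    · obtain ⟨u, v, hu, hv, h'⟩ := ih (hα.mono le_rfl hw₁ hw₂) hs hQ
        (fun u h₁ h₂ => hPQ u h₁ (h₂.trans hw₂)) (by linarith)
      exact ⟨u, v, ⟨hu.1, hu.2.trans hw₂⟩, ⟨hv.1, hv.2.trans hw₂⟩, h'⟩

/-- Exponential divergence: a path avoiding a ball of radius `R` around `p` whose endpoints have
a small Gromov product at `p` is exponentially long. -/
theorem le_gromov_of_avoids (hα : IsQuasiPath d α ℓ s t lam h) (H : IsHyperbolicDist d δ)
    {p : X} {R : ℝ} (hR : ∀ u, s ≤ u → u ≤ t → R ≤ d (α u) p) (n : ℕ) (hn : ℓ t - ℓ s ≤ 2 ^ n) :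
    2 * R - 1 - 2 * n * δ ≤ d (α s) p + d (α t) p - d (α s) (α t) := by
  induction n generalizing s t with
  | zero =>
    have := hα.dist_le s t le_rfl hα.le le_rfl
    have h₁ := hR s le_rfl hα.le
    have h₂ := hR t hα.le le_rfl
    simp only [pow_zero] at hn
    push_cast
    linarith
  | succ n ih =>
    have hst := hα.length_mono H le_rfl hα.le le_rfl
    obtain ⟨w, hw₁, hw₂, hw⟩ := hα.exists_length_eq (r := (ℓ s + ℓ t) / 2)
      (by linarith) (by linarith)
    rw [pow_succ] at hn
    have h₁ := ih (hα.mono le_rfl hw₁ hw₂) (fun u a b => hR u a (b.trans hw₂)) (by linarith)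
    have h₂ := ih (hα.mono hw₁ hw₂ le_rfl) (fun u a b => hR u (hw₁.trans a) b) (by linarith)
    have h₃ := H.four (α s) (α w) (α t) p
    have h₄ := le_min h₁ h₂
    push_cast
    linarith

theorem le_gromov_of_avoids' (hα : IsQuasiPath d α ℓ s t lam h) (H : IsHyperbolicDist d δ)
    {p : X} {R : ℝ} (hR : ∀ u, s ≤ u → u ≤ t → R ≤ d (α u) p) (n : ℕ) {u v : ℝ}
    (hu : u ∈ Icc s t) (hv : v ∈ Icc s t) (hn : lam * d (α u) (α v) + h ≤ 2 ^ n) :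
    2 * R - 1 - 2 * n * δ ≤ d (α u) p + d (α v) p - d (α u) (α v) := by
  rcases le_total u v with huv | huv
  · exact (hα.mono hu.1 huv hv.2).le_gromov_of_avoids H
      (fun w a b => hR w (hu.1.trans a) (b.trans hv.2)) n
      ((hα.len_le u v hu.1 huv hv.2).trans hn)
  · rw [H.symm (α u) (α v)] at hn ⊢
    rw [add_comm (d (α u) p)]
    exact (hα.mono hv.1 huv hu.2).le_gromov_of_avoids H
      (fun w a b => hR w (hv.1.trans a) (b.trans hu.2)) n
      ((hα.len_le v u hv.1 huv hu.2).trans hn)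

theorem close_of_close_add_one (H : IsHyperbolicDist d δ) (hδ : 0 ≤ δ) (hlam : 0 ≤ lam)
    (hα : IsQuasiPath d α ℓ s t lam h) (hβ : IsQuasiPath d β m s' t' 1 1)
    (hs : α s = β s') (ht : α t = β t') {R : ℝ} (hR₀ : 0 ≤ R) (n : ℕ)
    (hn : lam * (6 * R) + h ≤ 2 ^ n) (hnR : 2 + (n + 2) * δ < R)
    (hR : ∀ v ∈ Icc s' t', ∃ u ∈ Icc s t, d (β v) (α u) ≤ R) :
    ∀ v ∈ Icc s' t', ∃ u ∈ Icc s t, d (β v) (α u) ≤ R - 1 := by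
  intro v hv
  by_contra! hfar
  have hfar' : ∀ u, s ≤ u → u ≤ t → R - 1 ≤ d (α u) (β v) := fun u a b => by
    rw [H.symm]; exact (hfar u ⟨a, b⟩).le
  have hleft : ∃ v₁, s' ≤ v₁ ∧ v₁ ≤ v ∧ ∃ u₁ ∈ Icc s t, d (β v₁) (α u₁) ≤ R ∧
      m v - m v₁ ≤ 2 * R ∧
      2 * (R - 1) ≤ d (β v₁) (β v) + d (α u₁) (β v) - d (β v₁) (α u₁) := by
    rcases le_total (m v - m s') (2 * R) with hc | hc
    · refine ⟨s', le_rfl, hv.1, s, ⟨le_rfl, hα.le⟩, ?_, hc, ?_⟩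
      · rw [hs, H.self]; exact hR₀
      · rw [← hs, H.self]; linarith [hfar' s le_rfl hα.le]
    · obtain ⟨v₁, h₁, h₂, h₃⟩ := (hβ.mono le_rfl hv.1 hv.2).exists_length_eq
        (r := m v - 2 * R) (by linarith) (by linarith)
      obtain ⟨u₁, hu₁, hd⟩ := hR v₁ ⟨h₁, h₂.trans hv.2⟩
      refine ⟨v₁, h₁, h₂, u₁, hu₁, hd, by linarith, ?_⟩
      linarith [hβ.len_le v₁ v h₁ h₂ hv.2, hfar' u₁ hu₁.1 hu₁.2]
  have hright : ∃ v₂, v ≤ v₂ ∧ v₂ ≤ t' ∧ ∃ u₂ ∈ Icc s t, d (β v₂) (α u₂) ≤ R ∧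
      m v₂ - m v ≤ 2 * R ∧
      2 * (R - 1) ≤ d (β v₂) (β v) + d (α u₂) (β v) - d (β v₂) (α u₂) := by
    rcases le_total (m t' - m v) (2 * R) with hc | hc
    · refine ⟨t', hv.2, le_rfl, t, ⟨hα.le, le_rfl⟩, ?_, hc, ?_⟩
      · rw [ht, H.self]; exact hR₀
      · rw [← ht, H.self]; linarith [hfar' t hα.le le_rfl]
    · obtain ⟨v₂, h₁, h₂, h₃⟩ := (hβ.mono hv.1 hv.2 le_rfl).exists_length_eq
        (r := m v + 2 * R) (by linarith) (by linarith)
      obtain ⟨u₂, hu₂, hd⟩ := hR v₂ ⟨hv.1.trans h₁, h₂⟩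
      refine ⟨v₂, h₁, h₂, u₂, hu₂, hd, by linarith, ?_⟩
      rw [H.symm (β v₂) (β v)]
      linarith [hβ.len_le v v₂ hv.1 h₁ h₂, hfar' u₂ hu₂.1 hu₂.2]
  obtain ⟨v₁, a₁, b₁, u₁, hu₁, hd₁, hm₁, hg₁⟩ := hleft
  obtain ⟨v₂, a₂, b₂, u₂, hu₂, hd₂, hm₂, hg₂⟩ := hright
  have e₁ := hβ.dist_le v₁ v a₁ b₁ hv.2
  have e₂ := hβ.dist_le v v₂ hv.1 a₂ b₂
  have e₃ := hβ.dist_le v₁ v₂ a₁ (b₁.trans a₂) b₂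
  have e₄ := hβ.len_le v₁ v₂ a₁ (b₁.trans a₂) b₂
  have hdu : d (α u₁) (α u₂) ≤ 6 * R := by
    linarith [H.tri (α u₁) (β v₁) (α u₂), H.tri (β v₁) (β v₂) (α u₂), H.symm (α u₁) (β v₁)]
  have g := hα.le_gromov_of_avoids' H hfar' n hu₁ hu₂
    (by linarith [mul_le_mul_of_nonneg_left hdu hlam])
  have f₁ := H.four (β v₁) (α u₁) (α u₂) (β v)
  have f₂ := H.four (β v₁) (α u₂) (β v₂) (β v)
  rw [H.symm (α u₂) (β v₂), add_comm (d (α u₂) (β v))] at f₂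
  rw [H.symm (β v₂) (β v)] at f₂ hg₂
  have hnδ : 0 ≤ n * δ := by positivity
  rcases min_cases (d (β v₁) (β v) + d (α u₁) (β v) - d (β v₁) (α u₁))
    (d (α u₁) (β v) + d (α u₂) (β v) - d (α u₁) (α u₂)) with ⟨h₁, _⟩ | ⟨h₁, _⟩ <;>
  rcases min_cases (d (β v₁) (β v) + d (α u₂) (β v) - d (β v₁) (α u₂))
    (d (β v) (β v₂) + d (α u₂) (β v) - d (β v₂) (α u₂)) with ⟨h₂, _⟩ | ⟨h₂, _⟩ <;>
  · rw [h₁] at f₁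
    rw [h₂] at f₂
    linarith

theorem exists_close (H : IsHyperbolicDist d δ) (hδ : 0 ≤ δ) (hlam : 0 ≤ lam)
    (hα : IsQuasiPath d α ℓ s t lam h) (hβ : IsQuasiPath d β m s' t' 1 1)
    (hs : α s = β s') (ht : α t = β t') {R₀ : ℝ} (hR₀ : 0 ≤ R₀)
    (hn : ∀ R, R₀ ≤ R → ∃ n : ℕ, lam * (6 * R) + h ≤ 2 ^ n ∧ 2 + (n + 2) * δ < R) :
    ∀ v ∈ Icc s' t', ∃ u ∈ Icc s t, d (β v) (α u) ≤ R₀ := by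
  have key : ∀ k : ℕ, (∀ v ∈ Icc s' t', ∃ u ∈ Icc s t, d (β v) (α u) ≤ R₀ + k) →
      ∀ v ∈ Icc s' t', ∃ u ∈ Icc s t, d (β v) (α u) ≤ R₀ := by
    intro k
    induction k with
    | zero => simp
    | succ k ih =>
      intro hk
      obtain ⟨n, h₁, h₂⟩ := hn (R₀ + (k + 1 : ℕ)) (by push_cast; linarith [Nat.cast_nonneg (α := ℝ) k])
      refine ih fun v hv => ?_
      obtain ⟨u, hu, hd⟩ := close_of_close_add_one H hδ hlam hα hβ hs ht
        (by positivity) n h₁ h₂ hk v hv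
      exact ⟨u, hu, hd.trans (by push_cast; linarith)⟩
  obtain ⟨k, hk⟩ := exists_nat_ge (m t' - m s')
  refine key k fun v hv => ⟨s, ⟨le_rfl, hα.le⟩, ?_⟩
  rw [hs, H.symm]
  linarith [hβ.dist_le s' v le_rfl hv.1 hv.2, hβ.length_mono H hv.1 hv.2 le_rfl]

/-- Stability of quasigeodesics, in terms of Gromov products. -/
theorem gromov_le (H : IsHyperbolicDist d δ) (hδ : 0 ≤ δ) (hlam : 0 ≤ lam)
    (hα : IsQuasiPath d α ℓ s t lam h) (hβ : IsQuasiPath d β m s' t' 1 1)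
    (hs : α s = β s') (ht : α t = β t') {R₀ : ℝ} (hR₀ : 0 ≤ R₀)
    (hn : ∀ R, R₀ ≤ R → ∃ n : ℕ, lam * (6 * R) + h ≤ 2 ^ n ∧ 2 + (n + 2) * δ < R)
    {u : ℝ} (hu : u ∈ Icc s t) :
    d (α s) (α u) + d (α u) (α t) ≤
      d (α s) (α t) + (1 + 2 * (R₀ + lam * (2 * R₀ + 1) + h)) := by
  have hclose := exists_close H hδ hlam hα hβ hs ht hR₀ hn
  obtain ⟨v₁, v₂, hv₁, hv₂, ⟨u₁, h₁u, hu₁, hd₁⟩, ⟨u₂, h₂u, hu₂, hd₂⟩, hv⟩ :=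
    hβ.exists_close_pair H (P := fun v => ∃ w, s ≤ w ∧ w ≤ u ∧ d (β v) (α w) ≤ R₀)
    (Q := fun v => ∃ w, u ≤ w ∧ w ≤ t ∧ d (β v) (α w) ≤ R₀)
    ⟨s, le_rfl, hu.1, by rw [hs, H.self]; exact hR₀⟩
    ⟨t, hu.2, le_rfl, by rw [ht, H.self]; exact hR₀⟩
    (fun v h₁ h₂ => by
      obtain ⟨w, hw, hd⟩ := hclose v ⟨h₁, h₂⟩
      rcases le_total w u with h' | h'
      · exact Or.inl ⟨w, hw.1, h', hd⟩
      · exact Or.inr ⟨w, h', hw.2, hd⟩)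
  have e₁ := hα.dist_le u₁ u h₁u hu₁ hu.2
  have e₂ := hα.length_mono H hu.1 h₂u hu₂
  have e₃ := hα.len_le u₁ u₂ h₁u (hu₁.trans h₂u) hu₂
  have e₄ : d (α u₁) (α u₂) ≤ 2 * R₀ + 1 := by
    linarith [H.tri (α u₁) (β v₁) (α u₂), H.tri (β v₁) (β v₂) (α u₂), H.symm (α u₁) (β v₁)]
  have e₅ := mul_le_mul_of_nonneg_left e₄ hlam
  have e₆ : d (β v₁) (α u) ≤ R₀ + lam * (2 * R₀ + 1) + h := by
    linarith [H.tri (β v₁) (α u₁) (α u)]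
  have f₁ := hβ.dist_le s' v₁ le_rfl hv₁.1 hv₁.2
  have f₂ := hβ.dist_le v₁ t' hv₁.1 hv₁.2 le_rfl
  have f₃ := hβ.len_le s' t' le_rfl hβ.le le_rfl
  rw [hs, ht]
  linarith [H.tri (β s') (β v₁) (α u), H.tri (α u) (β v₁) (β t'), H.symm (α u) (β v₁)]

/-- A point with small Gromov product with respect to the endpoints of a path all of whose points
have small Gromov product is close to the path. -/
theorem exists_close_of_gromov_le (H : IsHyperbolicDist d δ) (hα : IsQuasiPath d α ℓ s t lam h)
    {C : ℝ} (hC : ∀ u ∈ Icc s t, d (α s) (α u) + d (α u) (α t) ≤ d (α s) (α t) + C) {p : X}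
    (hp : d (α s) p + d p (α t) ≤ d (α s) (α t) + C) :
    ∃ u ∈ Icc s t, d p (α u) ≤ C + 1 + 2 * δ := by
  obtain ⟨u, v, hu, hv, hP, hQ, huv⟩ := hα.exists_close_pair H
    (P := fun u => d (α s) (α u) - d (α u) (α t) ≤ d (α s) p - d p (α t))
    (Q := fun u => d (α s) p - d p (α t) ≤ d (α s) (α u) - d (α u) (α t))
    (by rw [H.self]; linarith [H.tri (α s) p (α t), H.tri p (α s) (α t), H.symm p (α s)])
    (by rw [H.self]; linarith [H.tri (α s) (α t) p, H.symm p (α t)])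
    (fun u _ _ => le_total _ _)
  refine ⟨u, hu, ?_⟩
  have f := H.four p (α t) (α u) (α s)
  have hCu := hC u hu
  simp only [H.symm _ (α s), H.symm (α t) (α u)] at f
  have g₁ := H.tri (α s) (α u) (α v)
  have g₂ := H.tri (α u) (α v) (α t)
  rcases min_cases (d (α s) p + d (α s) (α t) - d p (α t))
    (d (α s) (α t) + d (α s) (α u) - d (α u) (α t)) with ⟨h', _⟩ | ⟨h', _⟩ <;>
  · rw [h'] at f
    linarith

end IsQuasiPath

/-- Exponentials beat affine functions, in the form used for the stability of quasigeodesics. -/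
theorem exists_radius_pow_two (δ lam h : ℝ) (hδ : 0 ≤ δ) (hlam : 0 ≤ lam) :
    ∃ R₀ : ℝ, 0 ≤ R₀ ∧ ∀ R, R₀ ≤ R →
      ∃ n : ℕ, lam * (6 * R) + h ≤ 2 ^ n ∧ 2 + (n + 2) * δ < R := by
  have h₁ : Filter.Tendsto (fun n : ℕ => (n : ℝ) / 2 ^ n) Filter.atTop (nhds 0) := by
    simpa using tendsto_pow_const_div_const_pow_of_one_lt 1 (one_lt_two (α := ℝ))
  have h₂ : Filter.Tendsto (fun n : ℕ => (1 : ℝ) / 2 ^ n) Filter.atTop (nhds 0) := by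
    simpa using tendsto_pow_const_div_const_pow_of_one_lt 0 (one_lt_two (α := ℝ))
  have h₃ := ((h₁.const_mul (6 * lam * (δ + 1))).add
    (h₂.const_mul (lam * (6 * (4 * (δ + 1) + 2)) + h)))
  simp only [mul_zero, add_zero] at h₃
  obtain ⟨N, hN⟩ := Filter.eventually_atTop.1 (h₃.eventually (eventually_le_nhds zero_lt_one))
  refine ⟨(N + 3) * (δ + 1) + 2, by positivity, fun R hR => ?_⟩
  have hδ₁ : 0 < δ + 1 := by linarith
  have hle : (N + 3 : ℝ) ≤ (R - 2) / (δ + 1) := by rw [le_div_iff₀ hδ₁]; linarith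
  have hm : N + 3 ≤ ⌊(R - 2) / (δ + 1)⌋₊ := Nat.le_floor (by push_cast; exact hle)
  obtain ⟨n, hn⟩ := Nat.exists_eq_add_of_le' (le_trans (Nat.le_add_left 3 N) hm)
  have hNn : N ≤ n := by omega
  have hlow := Nat.floor_le (show 0 ≤ (R - 2) / (δ + 1) from le_trans (by positivity) hle)
  have hup := Nat.lt_floor_add_one ((R - 2) / (δ + 1))
  rw [hn, le_div_iff₀ hδ₁] at hlow
  rw [hn, div_lt_iff₀ hδ₁] at hup
  push_cast at hlow hup
  refine ⟨n, ?_, by nlinarith [Nat.cast_nonneg (α := ℝ) n]⟩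
  have h₄ := hN n hNn
  have hpow : (0 : ℝ) < 2 ^ n := by positivity
  rw [← mul_div_assoc, ← mul_div_assoc, ← add_div, div_le_one hpow, mul_one] at h₄
  refine le_trans ?_ h₄
  have := mul_le_mul_of_nonneg_left hup.le hlam
  linarith

namespace IsQuasiPath

variable {X : Type*} {d : X → X → ℝ} {α γ : ℝ → X} {ℓ m : ℝ → ℝ} {M u lam h c₀ δ : ℝ}

/-- If a function `g` grows linearly along a quasigeodesic `α`, then it grows linearly along each
quasigeodesic `γ` that starts at the same point and ends close to `α`. -/
theorem growth_of_close (H : IsHyperbolicDist d δ) (hδ : 0 ≤ δ) {g : X → ℝ}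
    (hg : ∀ x y, g y - g x ≤ d x y) {K κ C : ℝ} (hK : 1 ≤ K) (hκ : 0 ≤ κ) (hC₀ : 0 ≤ C)
    (hα : IsQuasiPath d α ℓ 0 M lam h)
    (hαC : ∀ a b c, 0 ≤ a → a ≤ b → b ≤ c → c ≤ M →
      d (α a) (α b) + d (α b) (α c) ≤ d (α a) (α c) + C)
    (hgrow : ∀ a b, 0 ≤ a → a ≤ b → b ≤ M → ℓ b - ℓ a ≤ K * (g (α b) - g (α a) + κ))
    (h₀ : γ 0 = α 0)
    (hγC : ∀ a b c, 0 ≤ a → a ≤ b → b ≤ c → c ≤ u →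
      d (γ a) (γ b) + d (γ b) (γ c) ≤ d (γ a) (γ c) + C)
    (hu : d (α 0) (γ u) + d (γ u) (α M) ≤ d (α 0) (α M) + (C + 2 * δ))
    {r : ℝ} (hr : 0 ≤ r) (hru : r ≤ u) :
    g (γ r) + d (γ r) (γ u) / K ≤ g (γ u) + (12 * C + 16 * δ + 4 + κ) := by
  have hK₀ : 0 < K := by linarith
  have hcl : ∀ p, d (α 0) p + d p (α M) ≤ d (α 0) (α M) + (2 * C + 2 * δ) →
      ∃ a ∈ Icc 0 M, d p (α a) ≤ 2 * C + 4 * δ + 1 := fun p hp => by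
    obtain ⟨a, ha, hpa⟩ := exists_close_of_gromov_le H hα
      (fun b hb => (hαC 0 b M le_rfl hb.1 hb.2 le_rfl).trans (by linarith)) hp
    exact ⟨a, ha, by linarith⟩
  have e₁ := hγC 0 r u le_rfl hr hru le_rfl
  rw [h₀] at e₁
  obtain ⟨b, hb, hbz⟩ := hcl (γ u) (by linarith)
  obtain ⟨a, ha, hav⟩ := hcl (γ r) (by linarith [H.tri (γ r) (γ u) (α M)])
  have hd := H.nonneg (γ r) (γ u)
  have hdK : d (γ r) (γ u) / K ≤ d (γ r) (γ u) := div_le_self hd hK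
  rcases le_total a b with hab | hab
  · have e₂ := (hα.dist_le a b ha.1 hab hb.2).trans (hgrow a b ha.1 hab hb.2)
    have e₃ : d (γ r) (γ u) ≤ d (α a) (α b) + 2 * (2 * C + 4 * δ + 1) := by
      linarith [H.tri (γ r) (α a) (γ u), H.tri (α a) (α b) (γ u), H.symm (γ u) (α b)]
    have e₄ : d (γ r) (γ u) / K ≤ (g (α b) - g (α a) + κ) + 2 * (2 * C + 4 * δ + 1) := by
      rw [div_le_iff₀ hK₀]
      nlinarith
    linarith [hg (α a) (γ r), hg (γ u) (α b), H.symm (γ r) (α a)]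
  · have e₂ := hαC 0 b a le_rfl hb.1 hab ha.2
    have e₃ : d (γ r) (γ u) ≤ 2 * C + 2 * (2 * C + 4 * δ + 1) := by
      linarith [H.tri (α 0) (γ r) (α a), H.tri (α 0) (α b) (γ u), H.symm (γ u) (α b),
        H.nonneg (α b) (α a)]
    linarith [hg (γ u) (γ r), H.symm (γ r) (γ u)]

end IsQuasiPath

theorem integral_one_div_add {A s t : ℝ} (hA : 0 < A) (hs : 0 ≤ s) (hst : s ≤ t) :
    IntervalIntegrable (fun r => 1 / (r + A)) MeasureTheory.volume s t ∧
      ∫ r in s..t, 1 / (r + A) = Real.log (t + A) - Real.log (s + A) := by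
  have hsA : 0 < s + A := by linarith
  have htA : 0 < t + A := by linarith
  constructor
  · refine ContinuousOn.intervalIntegrable (continuousOn_const.div (by fun_prop) fun r hr => ?_)
    rw [uIcc_of_le hst] at hr
    linarith [hr.1]
  · rw [intervalIntegral.integral_comp_add_right (fun r => 1 / r), integral_one_div_of_pos hsA htA,
      Real.log_div htA.ne' hsA.ne']

section Quasihyperbolic

variable {E : Type*} [NormedAddCommGroup E] {D : Set E}
  {γ σ : ℝ → E} {L M : ℝ}

theorem deltaBd_pos [NormedSpace ℝ E] (hD : IsOpen D) (hne : D ≠ univ) {z : E} (hz : z ∈ D) : 0 < deltaBd D z := by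
  have hfr : (frontier D).Nonempty := nonempty_frontier_iff.2 ⟨⟨z, hz⟩, hne⟩
  refine (isClosed_frontier.notMem_iff_infDist_pos hfr).1 fun h => ?_
  rw [hD.frontier_eq] at h
  exact h.2 hz

theorem deltaBd_le_add_dist (x y : E) : deltaBd D x ≤ deltaBd D y + dist x y :=
  infDist_le_infDist_add_dist

namespace IsArcLengthParam

theorem dist_le (hγ : IsArcLengthParam D γ L) {s t : ℝ} (hs : 0 ≤ s) (hst : s ≤ t) (ht : t ≤ L) :
    dist (γ s) (γ t) ≤ t - s := by
  have h := eVariationOn.edist_le γ (left_mem_Icc.2 hst) (right_mem_Icc.2 hst)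
  rw [hγ.2.2 s t hs hst ht, edist_dist] at h
  exact (ENNReal.ofReal_le_ofReal_iff (sub_nonneg.2 hst)).1 h

theorem continuousOn (hγ : IsArcLengthParam D γ L) : ContinuousOn γ (Icc 0 L) := by
  refine LipschitzOnWith.continuousOn (K := 1) (LipschitzOnWith.of_dist_le_mul fun s hs t ht => ?_)
  rw [NNReal.coe_one, one_mul, Real.dist_eq]
  rcases le_total s t with h | h
  · rw [abs_sub_comm]
    exact (hγ.dist_le hs.1 h ht.2).trans (le_abs_self _)
  · rw [dist_comm]
    exact (hγ.dist_le ht.1 h hs.2).trans (le_abs_self _)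

theorem continuousOn_density [NormedSpace ℝ E] (hD : IsOpen D) (hne : D ≠ univ) (hγ : IsArcLengthParam D γ L) :
    ContinuousOn (fun t => 1 / deltaBd D (γ t)) (Icc 0 L) :=
  continuousOn_const.div ((continuous_infDist_pt _).comp_continuousOn hγ.continuousOn)
    fun t ht => (deltaBd_pos hD hne (hγ.2.1 t ht)).ne'

theorem intervalIntegrable_density [NormedSpace ℝ E] (hD : IsOpen D) (hne : D ≠ univ) (hγ : IsArcLengthParam D γ L)
    {s t : ℝ} (hs : s ∈ Icc 0 L) (ht : t ∈ Icc 0 L) :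
    IntervalIntegrable (fun t => 1 / deltaBd D (γ t)) MeasureTheory.volume s t :=
  ((hγ.continuousOn_density hD hne).mono (uIcc_subset_Icc hs ht)).intervalIntegrable

theorem qhLength_sub [NormedSpace ℝ E] (hD : IsOpen D) (hne : D ≠ univ) (hγ : IsArcLengthParam D γ L)
    {s t : ℝ} (hs : s ∈ Icc 0 L) (ht : t ∈ Icc 0 L) :
    qhLength D γ 0 t - qhLength D γ 0 s = qhLength D γ s t := by
  have h₀ : (0 : ℝ) ∈ Icc 0 L := ⟨le_rfl, hγ.1⟩
  exact intervalIntegral.integral_interval_sub_left (hγ.intervalIntegrable_density hD hne h₀ ht)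
    (hγ.intervalIntegrable_density hD hne h₀ hs)

theorem continuousOn_qhLength [NormedSpace ℝ E] (hD : IsOpen D) (hne : D ≠ univ) (hγ : IsArcLengthParam D γ L) :
    ContinuousOn (qhLength D γ 0) (Icc 0 L) := by
  have h := intervalIntegral.continuousOn_primitive_interval
    ((hγ.continuousOn_density hD hne).integrableOn_Icc (μ := MeasureTheory.volume)
      |>.mono_set (uIcc_of_le hγ.1).subset)
  rwa [uIcc_of_le hγ.1] at h

theorem hasDerivAt_qhLength [NormedSpace ℝ E] (hD : IsOpen D) (hne : D ≠ univ) (hγ : IsArcLengthParam D γ L)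
    {t : ℝ} (ht : t ∈ Ioo 0 L) : HasDerivAt (qhLength D γ 0) (1 / deltaBd D (γ t)) t := by
  have hc := (hγ.continuousOn_density hD hne).mono Ioo_subset_Icc_self
  exact intervalIntegral.integral_hasDerivAt_right
    (hγ.intervalIntegrable_density hD hne ⟨le_rfl, hγ.1⟩ (Ioo_subset_Icc_self ht))
    (hc.stronglyMeasurableAtFilter isOpen_Ioo t ht) (hc.continuousAt (isOpen_Ioo.mem_nhds ht))

/-- If `Δ` grows exponentially along a curve, with respect to quasihyperbolic length, then the
length of the curve is controlled by `Δ` at its end. -/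
theorem le_mul_deltaBd_of_growth [NormedSpace ℝ E] (hD : IsOpen D) (hne : D ≠ univ) (hγ : IsArcLengthParam D γ L)
    {u ε C : ℝ} (hu : u ∈ Icc 0 L) (hε : 0 < ε)
    (hg : ∀ r, 0 ≤ r → r ≤ u → Real.log (deltaBd D (γ r)) + ε * qhLength D γ r u ≤
      Real.log (deltaBd D (γ u)) + C) :
    u ≤ Real.exp C / ε * deltaBd D (γ u) := by
  set B := deltaBd D (γ u) * Real.exp C
  have hΔu := deltaBd_pos hD hne (hγ.2.1 u hu)
  have hB : 0 < B := by positivity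
  have hmono : MonotoneOn (fun r => B / ε * Real.exp (-(ε * (qhLength D γ 0 u - qhLength D γ 0 r)))
      - r) (Icc 0 u) := by
    have hder : ∀ r ∈ Ioo 0 u, HasDerivAt
        (fun r => B / ε * Real.exp (-(ε * (qhLength D γ 0 u - qhLength D γ 0 r))) - r)
        (B / ε * (Real.exp (-(ε * (qhLength D γ 0 u - qhLength D γ 0 r))) *
          (-(ε * (0 - 1 / deltaBd D (γ r))))) - 1) r := fun r hr =>
      ((((((hasDerivAt_const r _).sub (hγ.hasDerivAt_qhLength hD hne
        ⟨hr.1, hr.2.trans_le hu.2⟩)).const_mul ε).neg).exp).const_mul _).sub (hasDerivAt_id r)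
    refine monotoneOn_of_deriv_nonneg (convex_Icc 0 u) ?_ ?_ ?_
    · have hcont := (hγ.continuousOn_qhLength hD hne).mono (Icc_subset_Icc_right hu.2)
      fun_prop
    · rw [interior_Icc]
      exact fun r hr => (hder r hr).differentiableAt.differentiableWithinAt
    · rw [interior_Icc]
      intro r hr
      rw [(hder r hr).deriv]
      have hrL : r ∈ Icc 0 L := ⟨hr.1.le, hr.2.le.trans hu.2⟩
      have hΔ := deltaBd_pos hD hne (hγ.2.1 r hrL)
      have hgr := hg r hr.1.le hr.2.le
      rw [← hγ.qhLength_sub hD hne hrL hu] at hgr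
      have hle : deltaBd D (γ r) ≤
          B * Real.exp (-(ε * (qhLength D γ 0 u - qhLength D γ 0 r))) := by
        rw [← Real.exp_log hΔ]
        rw [show B = Real.exp (Real.log (deltaBd D (γ u)) + C) by
          rw [Real.exp_add, Real.exp_log hΔu], ← Real.exp_add]
        exact Real.exp_le_exp.2 (by linarith)
      have heq : B / ε * (Real.exp (-(ε * (qhLength D γ 0 u - qhLength D γ 0 r))) *
          (-(ε * (0 - 1 / deltaBd D (γ r))))) =
          B * Real.exp (-(ε * (qhLength D γ 0 u - qhLength D γ 0 r))) / deltaBd D (γ r) := by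
        field_simp
        ring
      rw [heq, sub_nonneg, one_le_div hΔ]
      exact hle
  have h := hmono ⟨le_rfl, hu.1⟩ ⟨hu.1, le_rfl⟩ hu.1
  simp only [sub_self, mul_zero, neg_zero, Real.exp_zero, mul_one, sub_zero] at h
  have hpos : 0 ≤ B / ε * Real.exp (-(ε * (qhLength D γ 0 u - qhLength D γ 0 0))) := by positivity
  have hBε : B / ε = Real.exp C / ε * deltaBd D (γ u) := by ring
  linarith

theorem reverse (hγ : IsArcLengthParam D γ L) : IsArcLengthParam D (fun t => γ (L - t)) L := by
  refine ⟨hγ.1, fun t ht => hγ.2.1 _ ⟨by linarith [ht.2], by linarith [ht.1]⟩,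
    fun s t hs hst ht => ?_⟩
  have h := eVariationOn.comp_eq_of_antitoneOn γ (t := Icc s t) (fun t => L - t)
    (fun a _ b _ hab => sub_le_sub_left hab L)
  rw [image_const_sub_Icc] at h
  rw [show (fun t => γ (L - t)) = γ ∘ fun t => L - t from rfl, h,
    hγ.2.2 _ _ (by linarith) (by linarith) (by linarith)]
  congr 1
  ring

theorem subarc (hγ : IsArcLengthParam D γ L) {s t : ℝ} (hs : 0 ≤ s) (hst : s ≤ t) (ht : t ≤ L) :
    IsArcLengthParam D (fun r => γ (r + s)) (t - s) := by
  refine ⟨sub_nonneg.2 hst, fun r hr => hγ.2.1 _ ⟨by linarith [hr.1], by linarith [hr.2]⟩,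
    fun a b ha hab hb => ?_⟩
  have h := eVariationOn.comp_eq_of_monotoneOn γ (t := Icc a b) (fun r => r + s)
    (fun a _ b _ hab => by simpa using hab)
  rw [image_add_const_Icc] at h
  rw [show (fun r => γ (r + s)) = γ ∘ fun r => r + s from rfl, h,
    hγ.2.2 _ _ (by linarith) (by linarith) (by linarith)]
  congr 1
  ring

theorem concat (hγ : IsArcLengthParam D γ L) (hσ : IsArcLengthParam D σ M) (h : γ L = σ 0) :
    IsArcLengthParam D (fun t => if t ≤ L then γ t else σ (t - L)) (L + M) := by
  set f : ℝ → E := fun t => if t ≤ L then γ t else σ (t - L)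
  have hf₁ : ∀ t, t ≤ L → f t = γ t := fun t ht => if_pos ht
  have hf₂ : ∀ t, L ≤ t → f t = σ (t - L) := fun t ht => by
    rcases ht.eq_or_lt with rfl | ht
    · rw [hf₁ _ le_rfl, sub_self, h]
    · exact if_neg ht.not_ge
  have hv₁ : ∀ s t, 0 ≤ s → s ≤ t → t ≤ L →
      eVariationOn f (Icc s t) = ENNReal.ofReal (t - s) := fun s t hs hst ht => by
    rw [← hγ.2.2 s t hs hst ht]
    exact eVariationOn.congr fun r hr => hf₁ r (hr.2.trans ht)
  have hv₂ : ∀ s t, L ≤ s → s ≤ t → t ≤ L + M →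
      eVariationOn f (Icc s t) = ENNReal.ofReal (t - s) := fun s t hs hst ht => by
    have h₁ : eVariationOn f (Icc s t) = eVariationOn (σ ∘ fun r => r - L) (Icc s t) :=
      eVariationOn.congr fun r hr => hf₂ r (hs.trans hr.1)
    rw [h₁, eVariationOn.comp_eq_of_monotoneOn σ (t := Icc s t) (fun r => r - L)
      (fun a _ b _ hab => by simpa using hab), image_sub_const_Icc,
      hσ.2.2 _ _ (by linarith) (by linarith) (by linarith)]
    congr 1
    ring
  refine ⟨add_nonneg hγ.1 hσ.1, fun t ht => ?_, fun s t hs hst ht => ?_⟩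
  · rcases le_total t L with h' | h'
    · rw [hf₁ t h']
      exact hγ.2.1 t ⟨ht.1, h'⟩
    · rw [hf₂ t h']
      exact hσ.2.1 _ ⟨by linarith, by linarith [ht.2]⟩
  · rcases le_total t L with h₁ | h₁
    · exact hv₁ s t hs hst h₁
    rcases le_total L s with h₂ | h₂
    · exact hv₂ s t h₂ hst ht
    have hadd := eVariationOn.Icc_add_Icc f (s := univ) h₂ h₁ (mem_univ L)
    simp only [univ_inter] at hadd
    rw [← hadd, hv₁ s L hs h₂ le_rfl, hv₂ L t le_rfl h₁ ht,
      ← ENNReal.ofReal_add (by linarith) (by linarith)]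
    congr 1
    ring

end IsArcLengthParam

theorem qhLength_reverse (γ : ℝ → E) (L s t : ℝ) :
    qhLength D (fun r => γ (L - r)) s t = qhLength D γ (L - t) (L - s) :=
  intervalIntegral.integral_comp_sub_left (fun r => 1 / deltaBd D (γ r)) L

theorem qhLength_nonneg (γ : ℝ → E) {s t : ℝ} (hst : s ≤ t) : 0 ≤ qhLength D γ s t :=
  intervalIntegral.integral_nonneg hst fun _ _ => div_nonneg zero_le_one infDist_nonneg

theorem qhDist_le_qhLength (hγ : IsArcLengthParam D γ L) :
    qhDist D (γ 0) (γ L) ≤ qhLength D γ 0 L := by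
  refine csInf_le ⟨0, ?_⟩ ⟨γ, L, hγ, rfl, rfl, rfl⟩
  rintro _ ⟨γ', L', h', -, -, rfl⟩
  exact qhLength_nonneg γ' h'.1

theorem qhDist_le_qhLength_subarc (hγ : IsArcLengthParam D γ L) {s t : ℝ} (hs : 0 ≤ s)
    (hst : s ≤ t) (ht : t ≤ L) : qhDist D (γ s) (γ t) ≤ qhLength D γ s t := by
  have h := qhDist_le_qhLength (hγ.subarc hs hst ht)
  have hint : qhLength D (fun r => γ (r + s)) 0 (t - s) = qhLength D γ s t := by
    have := intervalIntegral.integral_comp_add_right (a := 0) (b := t - s)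
      (fun r => 1 / deltaBd D (γ r)) s
    simpa [qhLength] using this
  simpa [hint] using h

theorem qhDist_nonneg (x y : E) : 0 ≤ qhDist D x y := by
  refine Real.sInf_nonneg ?_
  rintro _ ⟨γ', L', h', -, -, rfl⟩
  exact qhLength_nonneg γ' h'.1

theorem qhDist_self {x : E} (hx : x ∈ D) : qhDist D x x = 0 := by
  have hγ : IsArcLengthParam D (fun _ => x) 0 := by
    refine ⟨le_rfl, fun _ _ => hx, fun s t hs hst ht => ?_⟩
    obtain rfl : s = t := by linarith
    simp
  refine le_antisymm ((qhDist_le_qhLength hγ).trans_eq ?_) (qhDist_nonneg x x)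
  simp [qhLength]

theorem qhDist_comm (x y : E) : qhDist D x y = qhDist D y x := by
  unfold qhDist
  congr 1
  ext l
  constructor <;>
  · rintro ⟨γ, L, hγ, rfl, rfl, rfl⟩
    exact ⟨_, L, hγ.reverse, by simp, by simp, by rw [qhLength_reverse]; simp⟩

/-- Every pair of points of `D` is joined by a curve whose quasihyperbolic length exceeds their
quasihyperbolic distance by at most `ε`. -/
theorem exists_qhLength_le {c : ℝ} (hJ : IsJohnDomain D c) {x y : E} (hx : x ∈ D) (hy : y ∈ D)
    {ε : ℝ} (hε : 0 < ε) : ∃ γ L, IsArcLengthParam D γ L ∧ γ 0 = x ∧ γ L = y ∧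
      qhLength D γ 0 L ≤ qhDist D x y + ε := by
  obtain ⟨γ₀, L₀, hγ₀, h₀, h₁, -⟩ := hJ x hx y hy
  obtain ⟨_, ⟨γ, L, hγ, hx, hy, rfl⟩, hlt⟩ := exists_lt_of_csInf_lt
    (s := { l : ℝ | ∃ γ : ℝ → E, ∃ L : ℝ, IsArcLengthParam D γ L ∧
      γ 0 = x ∧ γ L = y ∧ l = qhLength D γ 0 L })
    ⟨_, γ₀, L₀, hγ₀, h₀, h₁, rfl⟩ (lt_add_of_pos_right (qhDist D x y) hε)
  exact ⟨γ, L, hγ, hx, hy, hlt.le⟩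

theorem qhDist_triangle [NormedSpace ℝ E] (hD : IsOpen D) (hne : D ≠ univ) {c : ℝ} (hJ : IsJohnDomain D c)
    {x y z : E} (hx : x ∈ D) (hy : y ∈ D) (hz : z ∈ D) :
    qhDist D x z ≤ qhDist D x y + qhDist D y z := by
  refine le_of_forall_pos_le_add fun ε hε => ?_
  obtain ⟨γ, L, hγ, rfl, hγy, hγl⟩ := exists_qhLength_le hJ hx hy (half_pos hε)
  obtain ⟨σ, M, hσ, hσy, rfl, hσl⟩ := exists_qhLength_le hJ hy hz (half_pos hε)
  have hc := hγ.concat hσ (hγy.trans hσy.symm)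
  have h := qhDist_le_qhLength hc
  rw [← sub_add_cancel (qhLength D _ 0 (L + M)) (qhLength D _ 0 L),
    hc.qhLength_sub hD hne (s := L) ⟨hγ.1, by linarith [hσ.1]⟩ ⟨hc.1, le_rfl⟩] at h
  have h₁ : qhLength D (fun t => if t ≤ L then γ t else σ (t - L)) 0 L = qhLength D γ 0 L := by
    refine intervalIntegral.integral_congr fun t ht => ?_
    rw [uIcc_of_le hγ.1] at ht
    simp only [if_pos ht.2]
  have h₂ : qhLength D (fun t => if t ≤ L then γ t else σ (t - L)) L (L + M) =
      qhLength D σ 0 M := by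
    have h₃ := intervalIntegral.integral_comp_sub_right (a := L) (b := L + M)
      (fun r => 1 / deltaBd D (σ r)) L
    rw [sub_self, add_sub_cancel_left] at h₃
    rw [qhLength, qhLength, ← h₃]
    refine intervalIntegral.integral_congr fun t ht => ?_
    rw [uIcc_of_le (by linarith [hσ.1])] at ht
    rcases ht.1.eq_or_lt with rfl | ht'
    · simp [hγy, hσy]
    · simp only [if_neg ht'.not_ge]
  rw [h₁, h₂, if_pos hγ.1] at h
  have h₄ : (if L + M ≤ L then γ (L + M) else σ (L + M - L)) = σ M := by
    split_ifs with hM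
    · obtain rfl : M = 0 := by linarith [hσ.1]
      rw [add_zero, hγy, hσy]
    · rw [add_sub_cancel_left]
  rw [h₄] at h
  linarith

theorem log_deltaBd_sub_le_qhDist [NormedSpace ℝ E] (hD : IsOpen D) (hne : D ≠ univ) {c : ℝ}
    (hJ : IsJohnDomain D c) {x y : E} (hx : x ∈ D) (hy : y ∈ D) :
    Real.log (deltaBd D y) - Real.log (deltaBd D x) ≤ qhDist D x y := by
  refine le_of_forall_pos_le_add fun ε hε => ?_
  obtain ⟨γ, L, hγ, rfl, rfl, hγl⟩ := exists_qhLength_le hJ hx hy hε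
  refine le_trans ?_ hγl
  have hx₀ := deltaBd_pos hD hne hx
  have hy₀ := deltaBd_pos hD hne hy
  have hle : ∀ t ∈ Icc 0 L, deltaBd D (γ t) ≤ t + deltaBd D (γ 0) := fun t ht => by
    have := deltaBd_le_add_dist (D := D) (γ t) (γ 0)
    rw [dist_comm] at this
    linarith [hγ.dist_le le_rfl ht.1 ht.2]
  obtain ⟨hi, heq⟩ := integral_one_div_add hx₀ le_rfl hγ.1
  have hmono := intervalIntegral.integral_mono_on hγ.1 hi
    (hγ.intervalIntegrable_density hD hne ⟨le_rfl, hγ.1⟩ ⟨hγ.1, le_rfl⟩) fun t ht =>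
    one_div_le_one_div_of_le (deltaBd_pos hD hne (hγ.2.1 t ht)) (hle t ht)
  rw [heq, zero_add] at hmono
  exact le_trans (sub_le_sub_right (Real.log_le_log hy₀ (hle L ⟨hγ.1, le_rfl⟩)) _) hmono

/-- Along the first half of a cone arc, quasihyperbolic length is controlled by the growth of
`log Δ`. -/
theorem IsConeArc.qhLength_le [NormedSpace ℝ E] (hD : IsOpen D) (hne : D ≠ univ)
    (hσ : IsArcLengthParam D σ M) {c : ℝ} (hcone : IsConeArc D σ M c) (hc : 1 ≤ c) {s t : ℝ}
    (hs : 0 ≤ s) (hst : s ≤ t) (ht : t ≤ M / 2) :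
    qhLength D σ s t ≤ (2 * c + 1) *
      (Real.log (deltaBd D (σ t)) - Real.log (deltaBd D (σ s)) + Real.log (2 * c + 1)) := by
  have hM := hσ.1
  have h0 : (0 : ℝ) ∈ Icc 0 M := ⟨le_rfl, hM⟩
  have hA := deltaBd_pos hD hne (hσ.2.1 0 h0)
  set A := deltaBd D (σ 0)
  have hK : 0 < 2 * c + 1 := by linarith
  have hlow : ∀ r, 0 ≤ r → r ≤ M / 2 → r + A ≤ (2 * c + 1) * deltaBd D (σ r) := fun r h₁ h₂ => by
    have e₁ := hcone r ⟨h₁, by linarith⟩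
    rw [min_eq_left (by linarith)] at e₁
    have e₂ := deltaBd_le_add_dist (D := D) (σ 0) (σ r)
    have e₃ := hσ.dist_le le_rfl h₁ (by linarith)
    linarith
  have hup : deltaBd D (σ s) ≤ s + A := by
    have e₂ := deltaBd_le_add_dist (D := D) (σ s) (σ 0)
    rw [dist_comm] at e₂
    linarith [hσ.dist_le le_rfl hs (by linarith)]
  have hsM : s ∈ Icc 0 M := ⟨hs, by linarith⟩
  have htM : t ∈ Icc 0 M := ⟨hs.trans hst, by linarith⟩
  have hΔs := deltaBd_pos hD hne (hσ.2.1 s hsM)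
  have hΔt := deltaBd_pos hD hne (hσ.2.1 t htM)
  obtain ⟨hi, heq⟩ := integral_one_div_add hA hs hst
  have hmono := intervalIntegral.integral_mono_on hst
    (hσ.intervalIntegrable_density hD hne hsM htM) (hi.const_mul (2 * c + 1)) fun r hr => by
      rw [mul_one_div, div_le_div_iff₀
        (deltaBd_pos hD hne (hσ.2.1 r ⟨hs.trans hr.1, hr.2.trans htM.2⟩)) (by linarith [hr.1])]
      linarith [hlow r (hs.trans hr.1) (hr.2.trans ht)]
  rw [intervalIntegral.integral_const_mul, heq] at hmono
  refine le_trans hmono (mul_le_mul_of_nonneg_left ?_ hK.le)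
  have e₁ := Real.log_le_log (by linarith) (hlow t (hs.trans hst) ht)
  rw [Real.log_mul hK.ne' hΔt.ne'] at e₁
  have e₂ := Real.log_le_log hΔs hup
  linarith

theorem IsConeArc.reverse {b : ℝ} (h : IsConeArc D σ M b) :
    IsConeArc D (fun t => σ (M - t)) M b := fun t ht => by
  have := h (M - t) ⟨by linarith [ht.2], by linarith [ht.1]⟩
  rwa [sub_sub_cancel, min_comm] at this

theorem IsNeargeodesic.reverse {c₀ : ℝ} (h : IsNeargeodesic D γ L c₀) :
    IsNeargeodesic D (fun t => γ (L - t)) L c₀ := by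
  refine ⟨h.1.reverse, fun s t hs hst ht => ?_⟩
  rw [qhLength_reverse, qhDist_comm]
  exact h.2 _ _ (by linarith) (by linarith) (by linarith)

theorem isHyperbolicDist_qhDist [NormedSpace ℝ E] (hD : IsOpen D) (hne : D ≠ univ) {c δ : ℝ}
    (hJ : IsJohnDomain D c) (hG : IsGromovHyperbolic D δ) :
    IsHyperbolicDist (fun x y : D => qhDist D x y) δ where
  self x := qhDist_self x.2
  symm x y := qhDist_comm _ _
  nonneg x y := qhDist_nonneg _ _
  tri x y z := qhDist_triangle hD hne hJ x.2 y.2 z.2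
  four x y z p := by
    have h := hG x x.2 y y.2 z z.2 p p.2
    simp only [gromovProd] at h
    rw [min_div_div_right (zero_le_two (α := ℝ))] at h
    linarith

/-- An arclength-parametrized curve in `D`, as a map into the subtype `D`. -/
noncomputable def IsArcLengthParam.lift (hγ : IsArcLengthParam D γ L) (t : ℝ) : D :=
  ⟨γ (projIcc 0 L hγ.1 t), hγ.2.1 _ (projIcc 0 L hγ.1 t).2⟩

theorem IsArcLengthParam.coe_lift (hγ : IsArcLengthParam D γ L) {t : ℝ} (h₀ : 0 ≤ t)
    (h₁ : t ≤ L) : (hγ.lift t : E) = γ t := by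
  simp [IsArcLengthParam.lift, projIcc_of_mem hγ.1 ⟨h₀, h₁⟩]

theorem IsArcLengthParam.isQuasiPath [NormedSpace ℝ E] (hD : IsOpen D) (hne : D ≠ univ)
    (hγ : IsArcLengthParam D γ L) {t lam h : ℝ} (h₀ : 0 ≤ t) (h₁ : t ≤ L)
    (hlen : ∀ a b, 0 ≤ a → a ≤ b → b ≤ t →
      qhLength D γ a b ≤ lam * qhDist D (γ a) (γ b) + h) :
    IsQuasiPath (fun x y : D => qhDist D x y) hγ.lift (qhLength D γ 0) 0 t lam h where
  le := h₀
  cont := (hγ.continuousOn_qhLength hD hne).mono (Icc_subset_Icc_right h₁)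
  dist_le a b ha hab hb := by
    rw [hγ.coe_lift ha (by linarith), hγ.coe_lift (by linarith) (by linarith),
      hγ.qhLength_sub hD hne ⟨by linarith, by linarith⟩ ⟨by linarith, by linarith⟩]
    exact qhDist_le_qhLength_subarc hγ ha hab (by linarith)
  len_le a b ha hab hb := by
    rw [hγ.coe_lift ha (by linarith), hγ.coe_lift (by linarith) (by linarith),
      hγ.qhLength_sub hD hne ⟨by linarith, by linarith⟩ ⟨by linarith, by linarith⟩]
    exact hlen a b ha hab hb

/-- Quasigeodesics are `C`-almost geodesic, in the sense of Gromov products. -/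
def HasGromovBound {X : Type*} (d : X → X → ℝ) (lam h C : ℝ) : Prop :=
  ∀ (α : ℝ → X) (ℓ : ℝ → ℝ) (s t : ℝ), IsQuasiPath d α ℓ s t lam h →
    ∀ a b c, s ≤ a → a ≤ b → b ≤ c → c ≤ t → d (α a) (α b) + d (α b) (α c) ≤ d (α a) (α c) + C

theorem HasGromovBound.mono {X : Type*} {d : X → X → ℝ} {lam h C C' : ℝ}
    (H : HasGromovBound d lam h C) (hC : C ≤ C') : HasGromovBound d lam h C' :=
  fun α ℓ s t hα a b c h₁ h₂ h₃ h₄ =>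
    (H α ℓ s t hα a b c h₁ h₂ h₃ h₄).trans (by linarith)

theorem hasGromovBound_qhDist [NormedSpace ℝ E] (hD : IsOpen D) (hne : D ≠ univ) {c δ : ℝ}
    (hJ : IsJohnDomain D c) (hG : IsGromovHyperbolic D δ) (hδ : 0 ≤ δ) {lam h R₀ : ℝ}
    (hlam : 0 ≤ lam) (hR₀ : 0 ≤ R₀)
    (hn : ∀ R, R₀ ≤ R → ∃ n : ℕ, lam * (6 * R) + h ≤ 2 ^ n ∧ 2 + (n + 2) * δ < R) :
    HasGromovBound (fun x y : D => qhDist D x y) lam h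
      (1 + 2 * (R₀ + lam * (2 * R₀ + 1) + h)) := by
  intro α ℓ s t hα a b e ha hab hbe he
  have H := isHyperbolicDist_qhDist hD hne hJ hG
  obtain ⟨β, N, hβ, h₀, h₁, hlen⟩ := exists_qhLength_le hJ (α a).2 (α e).2 one_pos
  have hβ' : IsQuasiPath (fun x y : D => qhDist D x y) hβ.lift (qhLength D β 0) 0 N 1 1 := by
    refine hβ.isQuasiPath hD hne hβ.1 le_rfl fun u v hu huv hv => ?_
    have hu' : u ∈ Icc 0 N := ⟨hu, huv.trans hv⟩
    have hv' : v ∈ Icc 0 N := ⟨hu.trans huv, hv⟩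
    have h0 : (0 : ℝ) ∈ Icc 0 N := ⟨le_rfl, hβ.1⟩
    have hN : N ∈ Icc 0 N := ⟨hβ.1, le_rfl⟩
    have t₁ := qhDist_triangle hD hne hJ (hβ.2.1 0 h0) (hβ.2.1 u hu') (hβ.2.1 N hN)
    have t₂ := qhDist_triangle hD hne hJ (hβ.2.1 u hu') (hβ.2.1 v hv') (hβ.2.1 N hN)
    have l₁ := qhDist_le_qhLength_subarc hβ le_rfl hu'.1 hu'.2
    have l₂ := qhDist_le_qhLength_subarc hβ hv'.1 hv'.2 le_rfl
    rw [h₀, h₁] at t₁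
    rw [h₁] at t₂ l₂
    rw [h₀] at l₁
    rw [← hβ.qhLength_sub hD hne hv' hN] at l₂
    rw [← hβ.qhLength_sub hD hne hu' hv']
    linarith
  exact (hα.mono ha (hab.trans hbe) he).gromov_le H hδ hlam hβ'
    (Subtype.ext (by rw [hβ.coe_lift le_rfl hβ.1, h₀]))
    (Subtype.ext (by rw [hβ.coe_lift hβ.1 le_rfl, h₁])) hR₀ hn ⟨hab, hbe⟩

/-- If a point of a neargeodesic is close to the first half of a cone arc starting at the same
point, then it satisfies the cone condition. -/
theorem IsNeargeodesic.le_mul_deltaBd [NormedSpace ℝ E] (hD : IsOpen D) (hne : D ≠ univ)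
    {c c₀ δ C : ℝ} (hc : 1 ≤ c) (hc₀ : 1 ≤ c₀) (hJ : IsJohnDomain D c)
    (hG : IsGromovHyperbolic D δ) (hδ : 0 ≤ δ) (hC₀ : 0 ≤ C)
    (hC₁ : HasGromovBound (fun x y : D => qhDist D x y) (2 * c + 1)
      ((2 * c + 1) * Real.log (2 * c + 1)) C)
    (hC₂ : HasGromovBound (fun x y : D => qhDist D x y) c₀ 0 C)
    (hγ : IsNeargeodesic D γ L c₀) (hσ : IsArcLengthParam D σ M) (hcone : IsConeArc D σ M c)
    (h₀ : γ 0 = σ 0) {u : ℝ} (hu : u ∈ Icc 0 L)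
    (hclose : qhDist D (σ 0) (γ u) + qhDist D (γ u) (σ (M / 2)) ≤
      qhDist D (σ 0) (σ (M / 2)) + (C + 2 * δ)) :
    u ≤ Real.exp (12 * C + 16 * δ + 4 + Real.log (2 * c + 1)) / (1 / (c₀ * (2 * c + 1))) *
      deltaBd D (γ u) := by
  have hK : 1 ≤ 2 * c + 1 := by linarith
  have hM := hσ.1
  have hg : ∀ x y : D, Real.log (deltaBd D y) - Real.log (deltaBd D x) ≤ qhDist D x y :=
    fun x y => log_deltaBd_sub_le_qhDist hD hne hJ x.2 y.2
  have hqσ : IsQuasiPath (fun x y : D => qhDist D x y) hσ.lift (qhLength D σ 0) 0 (M / 2)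
      (2 * c + 1) ((2 * c + 1) * Real.log (2 * c + 1)) := by
    refine hσ.isQuasiPath hD hne (by linarith) (by linarith) fun a b ha hab hb => ?_
    refine (hcone.qhLength_le hD hne hσ hc ha hab hb).trans ?_
    rw [← mul_add]
    refine mul_le_mul_of_nonneg_left ?_ (by linarith)
    linarith [log_deltaBd_sub_le_qhDist hD hne hJ (hσ.2.1 a ⟨ha, by linarith⟩)
      (hσ.2.1 b ⟨by linarith, by linarith⟩)]
  have hqγ : IsQuasiPath (fun x y : D => qhDist D x y) hγ.1.lift (qhLength D γ 0) 0 u c₀ 0 :=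
    hγ.1.isQuasiPath hD hne hu.1 hu.2 fun a b ha hab hb => by
      rw [add_zero]
      exact hγ.2 a b ha hab (hb.trans hu.2)
  refine hγ.1.le_mul_deltaBd_of_growth hD hne hu (by positivity) fun r hr hru => ?_
  have key := hqσ.growth_of_close (isHyperbolicDist_qhDist hD hne hJ hG) hδ
    (g := fun x : D => Real.log (deltaBd D x)) hg (γ := hγ.1.lift) (u := u) (C := C) hK
    (Real.log_nonneg hK) hC₀ (hC₁ _ _ _ _ hqσ)
    (fun a b ha hab hb => by
      rw [hσ.coe_lift ha (by linarith), hσ.coe_lift (by linarith) (by linarith),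
        hσ.qhLength_sub hD hne ⟨by linarith, by linarith⟩ ⟨by linarith, by linarith⟩]
      exact hcone.qhLength_le hD hne hσ hc ha hab hb)
    (Subtype.ext (by rw [hσ.coe_lift le_rfl hM, hγ.1.coe_lift le_rfl hγ.1.1, h₀]))
    (hC₂ _ _ _ _ hqγ)
    (by
      rw [hσ.coe_lift le_rfl hM, hγ.1.coe_lift hu.1 hu.2,
        hσ.coe_lift (by linarith) (by linarith)]
      exact hclose) hr hru
  simp only [hγ.1.coe_lift hr (hru.trans hu.2), hγ.1.coe_lift hu.1 hu.2] at key
  have hlen := hγ.2 r u hr hru hu.2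
  have hle : 1 / (c₀ * (2 * c + 1)) * qhLength D γ r u ≤
      qhDist D (γ r) (γ u) / (2 * c + 1) := by
    rw [one_div_mul_eq_div, div_le_div_iff₀ (by positivity) (by positivity)]
    nlinarith
  linarith

end Quasihyperbolic

/-- Let `E` be a real Banach space and `D ⊊ E` a `c`-John domain (`c ≥ 1`).
If `D` is Gromov hyperbolic, i.e. `(D, k_D)` is `δ`-hyperbolic for some `δ ≥ 0`, then every
`c₀`-neargeodesic in `D` (`c₀ ≥ 1`) is a `b`-cone arc, where `b` depends only on `c, c₀, δ`. -/
theorem neargeodesics_in_GH_John_domains_are_cone_arcs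
    (c c₀ δ : ℝ) (hc : 1 ≤ c) (hc₀ : 1 ≤ c₀) (hδ : 0 ≤ δ) :
    ∃ b : ℝ, ∀ (E : Type*) [NormedAddCommGroup E] [NormedSpace ℝ E] [CompleteSpace E]
      (D : Set E), IsOpen D → IsConnected D → D ≠ Set.univ →
      IsJohnDomain D c → IsGromovHyperbolic D δ →
      ∀ (γ : ℝ → E) (L : ℝ), IsNeargeodesic D γ L c₀ → IsConeArc D γ L b := by
  have hK : 1 ≤ 2 * c + 1 := by linarith
  have hlogK := Real.log_nonneg hK
  obtain ⟨R₁, hR₁, hn₁⟩ := exists_radius_pow_two δ (2 * c + 1)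
    ((2 * c + 1) * Real.log (2 * c + 1)) hδ (by linarith)
  obtain ⟨R₂, hR₂, hn₂⟩ := exists_radius_pow_two δ c₀ 0 hδ (by linarith)
  set C₁ := 1 + 2 * (R₁ + (2 * c + 1) * (2 * R₁ + 1) + (2 * c + 1) * Real.log (2 * c + 1))
  set C₂ := 1 + 2 * (R₂ + c₀ * (2 * R₂ + 1) + 0)
  have hC₀ : 0 ≤ max C₁ C₂ := le_max_of_le_left (by positivity)
  refine ⟨Real.exp (12 * max C₁ C₂ + 16 * δ + 4 + Real.log (2 * c + 1)) /
    (1 / (c₀ * (2 * c + 1))), ?_⟩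
  intro E _ _ _ D hD _ hne hJ hG γ L hγ t ht
  have hB₁ := (hasGromovBound_qhDist hD hne hJ hG hδ (by linarith) hR₁ hn₁).mono
    (le_max_left C₁ C₂)
  have hB₂ := (hasGromovBound_qhDist hD hne hJ hG hδ (by linarith) hR₂ hn₂).mono
    (le_max_right C₁ C₂)
  have hL := hγ.1.1
  have h0 : (0 : ℝ) ∈ Icc 0 L := ⟨le_rfl, hL⟩
  have hLL : L ∈ Icc 0 L := ⟨hL, le_rfl⟩
  obtain ⟨σ, M, hσ, hσ₀, hσM, hcone⟩ := hJ _ (hγ.1.2.1 0 h0) _ (hγ.1.2.1 L hLL)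
  have hM := hσ.1
  have hw : M / 2 ∈ Icc 0 M := ⟨by linarith, by linarith⟩
  have hqγ := hγ.1.isQuasiPath hD hne hL le_rfl (lam := c₀) (h := 0) fun a b ha hab hb => by
    rw [add_zero]
    exact hγ.2 a b ha hab hb
  have hgr := hB₂ _ _ _ _ hqγ 0 t L le_rfl ht.1 ht.2 le_rfl
  simp only [hγ.1.coe_lift le_rfl hL, hγ.1.coe_lift ht.1 ht.2, hγ.1.coe_lift hL le_rfl] at hgr
  have hfour := (isHyperbolicDist_qhDist hD hne hJ hG).four ⟨γ 0, hγ.1.2.1 0 h0⟩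
    ⟨σ (M / 2), hσ.2.1 _ hw⟩ ⟨γ L, hγ.1.2.1 L hLL⟩ ⟨γ t, hγ.1.2.1 t ht⟩
  simp only at hfour
  rw [qhDist_comm (γ L) (γ t)] at hfour
  rcases min_le_iff.1 (show min _ _ ≤ max C₁ C₂ + 2 * δ by linarith) with h | h
  · refine (min_le_left _ _).trans
      (hγ.le_mul_deltaBd hD hne hc hc₀ hJ hG hδ hC₀ hB₁ hB₂ hσ hcone hσ₀.symm ht ?_)
    rw [hσ₀, qhDist_comm (γ t)]
    linarith
  · have hrev := hγ.reverse.le_mul_deltaBd hD hne hc hc₀ hJ hG hδ hC₀ hB₁ hB₂ hσ.reverse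
      hcone.reverse (by simp [hσM]) (u := L - t) ⟨by linarith [ht.2], by linarith [ht.1]⟩
    simp only [sub_sub_cancel, sub_zero, sub_half, hσM] at hrev
    refine (min_le_right _ _).trans (hrev ?_)
    rw [qhDist_comm (γ L) (γ t), qhDist_comm (γ t) (σ (M / 2)), qhDist_comm (γ L) (σ (M / 2))]
    linarith
end

section
/- Let E be a real Banach space, D ⊊ E a domain, and α a c-cone arc (c ≥ 1) joining x, y ∈ D with arclength midpoint x₀. If z₁ ∈ α[x,x₀] and w ∈ α[z₁,x₀] (so w lies on α between z₁ and x₀), then l(α[z₁,w]) + Δ(z₁) ≤ 3c·Δ(w); in particular Δ(z₁) ≤ 2c·Δ(w) and l(α[z₁,w]) ≤ c·Δ(w). -/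
open Set Metric

/-- An arclength parametrization is nonexpanding. -/
theorem IsArcLengthParam.dist_le_s4 {E : Type*} [NormedAddCommGroup E] [NormedSpace ℝ E]
    {D : Set E} {γ : ℝ → E} {L s t : ℝ} (hγ : IsArcLengthParam D γ L)
    (hs : 0 ≤ s) (hst : s ≤ t) (ht : t ≤ L) : dist (γ s) (γ t) ≤ t - s := by
  have h := eVariationOn.edist_le γ (left_mem_Icc.2 hst) (right_mem_Icc.2 hst)
  rw [hγ.2.2 s t hs hst ht, edist_dist] at h
  exact (ENNReal.ofReal_le_ofReal_iff (sub_nonneg.2 hst)).1 h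

/-- Let `D ⊊ E` be a domain and `α` a `c`-cone arc (`c ≥ 1`) joining
`x, y ∈ D` with arclength midpoint `x₀ = α (L/2)`. If `z₁ = α s ∈ α[x,x₀]` and
`w = α t ∈ α[z₁,x₀]`, then `l(α[z₁,w]) + Δ(z₁) ≤ 3c * Δ(w)`; in particular
`Δ(z₁) ≤ 2c * Δ(w)` and `l(α[z₁,w]) ≤ c * Δ(w)`. (Here `l(α[z₁,w]) = t - s`.) -/
theorem cone_arc_first_half_distance_estimates
    {E : Type*} [NormedAddCommGroup E] [NormedSpace ℝ E] [CompleteSpace E]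
    (D : Set E) (hD : IsOpen D) (hconn : IsConnected D) (hne : D ≠ Set.univ)
    (c : ℝ) (hc : 1 ≤ c) (α : ℝ → E) (L : ℝ) (x y : E)
    (hα : IsArcLengthParam D α L) (hx : α 0 = x) (hy : α L = y)
    (hcone : IsConeArc D α L c)
    (s t : ℝ) (hs : 0 ≤ s) (hst : s ≤ t) (ht : t ≤ L / 2) :
    (t - s) + deltaBd D (α s) ≤ 3 * c * deltaBd D (α t) ∧
    deltaBd D (α s) ≤ 2 * c * deltaBd D (α t) ∧
    t - s ≤ c * deltaBd D (α t) := by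
  have hdist := hα.dist_le_s4 hs hst (by linarith)
  have hΔ : deltaBd D (α s) ≤ deltaBd D (α t) + dist (α s) (α t) :=
    infDist_le_infDist_add_dist
  have hΔt : 0 ≤ deltaBd D (α t) := infDist_nonneg
  have hct := hcone t ⟨by linarith, by linarith⟩
  rw [min_eq_left (by linarith)] at hct
  have hle := le_mul_of_one_le_left hΔt hc
  refine ⟨?_, ?_, ?_⟩ <;> linarith
end
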